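/- Let θ₁, θ₂ ∈ (0, π) be real numbers such that 1, θ₁/(2π), θ₂/(2π) are linearly independent over ℚ, and let a₁, b₁, a₂, b₂ be real numbers with −1 ≤ aᵢ ≤ bᵢ ≤ 1 for i = 1, 2. Then lim_{x→∞} (1/x)·#{ν ≤ x : sin(νθ₁) ∈ [a₁, b₁] and sin(νθ₂) ∈ [a₂, b₂]} = (arcsin(b₁) − arcsin(a₁))·(arcsin(b₂) − arcsin(a₂))/π². -/

import Mathlib

open Real Filter
open MeasureTheory Topology
open scoped ENNReal

theorem mFourier_add_apply {d : Type*} [Fintype d] (n : d → ℤ) (x y : UnitAddTorus d) :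
    UnitAddTorus.mFourier n (x + y) = UnitAddTorus.mFourier n x * UnitAddTorus.mFourier n y := by
  simp [UnitAddTorus.mFourier, fourier_apply, AddCircle.toCircle_add, Finset.prod_mul_distrib]

theorem mFourier_nsmul_apply {d : Type*} [Fintype d] (n : d → ℤ) (k : ℕ) (x : UnitAddTorus d) :
    UnitAddTorus.mFourier n (k • x) = UnitAddTorus.mFourier n x ^ k := by
  induction k with
  | zero => simp [UnitAddTorus.mFourier, fourier_apply]
  | succ k ih => rw [succ_nsmul, mFourier_add_apply, ih, pow_succ]

theorem tendsto_of_tendsto_integral_mFourier {d ι : Type*} [Fintype d] {l : Filter ι}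
    {μ : ι → ProbabilityMeasure (UnitAddTorus d)} {μ₀ : ProbabilityMeasure (UnitAddTorus d)}
    (h : ∀ n : d → ℤ, Tendsto (fun i ↦ ∫ x, UnitAddTorus.mFourier n x ∂(μ i : Measure _)) l
      (𝓝 (∫ x, UnitAddTorus.mFourier n x ∂(μ₀ : Measure _)))) :
    Tendsto μ l (𝓝 μ₀) := by
  refine ProbabilityMeasure.tendsto_of_tight_of_separatesPoints ℂ
    (A := (UnitAddTorus.mFourierSubalgebra d).comap
      (BoundedContinuousFunction.toContinuousMapStarₐ ℂ)) ?_ ?_ ?_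
  · exact .of_compactSpace
  · intro x y hxy
    obtain ⟨_, ⟨f, hf, rfl⟩, hne⟩ := UnitAddTorus.mFourierSubalgebra_separatesPoints hxy
    exact ⟨_, ⟨f, ⟨BoundedContinuousFunction.mkOfCompact f, hf, rfl⟩, rfl⟩, hne⟩
  · intro g hg
    have key : ∀ f ∈ Submodule.span ℂ (Set.range (UnitAddTorus.mFourier (d := d))),
        Tendsto (fun i ↦ ∫ x, f x ∂(μ i : Measure _)) l (𝓝 (∫ x, f x ∂(μ₀ : Measure _))) := by
      have h_int (ν : ProbabilityMeasure (UnitAddTorus d)) (f : C(UnitAddTorus d, ℂ)) :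
          Integrable f (ν : Measure _) :=
        f.continuous.integrable_of_hasCompactSupport (.of_compactSpace f)
      intro f hf
      induction hf using Submodule.span_induction with
      | mem f hf => obtain ⟨n, rfl⟩ := hf; exact h n
      | zero => simpa using tendsto_const_nhds
      | add f g _ _ hf hg =>
        simpa [integral_add (h_int _ f) (h_int _ g)] using hf.add hg
      | smul c f _ hf => simpa [integral_const_mul] using hf.const_mul c
    refine key g.toContinuousMap ?_
    rw [← UnitAddTorus.mFourierSubalgebra_coe]
    exact hg

theorem tendsto_average_pow_succ {z : ℂ} (hz : ‖z‖ = 1) (hz1 : z ≠ 1) :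
    Tendsto (fun N : ℕ ↦ ((N : ℂ) + 1)⁻¹ * ∑ k ∈ Finset.range (N + 1), z ^ (k + 1)) atTop
      (𝓝 0) := by
  have hbound (N : ℕ) : ‖((N : ℂ) + 1)⁻¹ * ∑ k ∈ Finset.range (N + 1), z ^ (k + 1)‖
      ≤ (1 / ((N : ℝ) + 1)) * (2 / ‖z - 1‖) := by
    have hN : ‖((N : ℂ) + 1)⁻¹‖ = 1 / ((N : ℝ) + 1) := by
      rw [norm_inv, one_div]; norm_cast
    have hsum : ∑ k ∈ Finset.range (N + 1), z ^ (k + 1) = (z ^ (N + 1) - 1) / (z - 1) * z := by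
      simp_rw [pow_succ z, ← Finset.sum_mul]
      rw [geom_sum_eq hz1, pow_succ]
    rw [norm_mul, hN, hsum, norm_mul, norm_div, hz, mul_one]
    gcongr
    calc ‖z ^ (N + 1) - 1‖ ≤ ‖z ^ (N + 1)‖ + ‖(1 : ℂ)‖ := norm_sub_le _ _
      _ = 2 := by rw [norm_pow, hz]; norm_num
  refine squeeze_zero_norm hbound ?_
  simpa using tendsto_one_div_add_atTop_nhds_zero_nat.mul_const (2 / ‖z - 1‖)

/-- The uniform probability measure on the first `N + 1` nonzero multiples of `θ`. -/
noncomputable def empiricalMeasure {G : Type*} [AddMonoid G] [MeasurableSpace G]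
    (θ : G) (N : ℕ) : ProbabilityMeasure G :=
  ⟨((N + 1 : ℕ) : ℝ≥0∞)⁻¹ • ∑ k ∈ Finset.range (N + 1), Measure.dirac ((k + 1) • θ), ⟨by
    simp only [Measure.smul_apply, Measure.finsetSum_apply, measure_univ, Finset.sum_const,
      Finset.card_range, nsmul_eq_mul, mul_one, smul_eq_mul]
    exact ENNReal.inv_mul_cancel (by simp) (by simp)⟩⟩

/-- The Haar probability measure on the torus. -/
noncomputable def torusMeasure (d : Type*) [Fintype d] : ProbabilityMeasure (UnitAddTorus d) :=
  ⟨Measure.pi fun _ ↦ (volume : Measure UnitAddCircle), ⟨by simp [Measure.pi_univ]⟩⟩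

theorem tendsto_empiricalMeasure {d : Type*} [Fintype d] {θ : UnitAddTorus d}
    (hθ : ∀ n : d → ℤ, n ≠ 0 → UnitAddTorus.mFourier n θ ≠ 1) :
    Tendsto (empiricalMeasure θ) atTop (𝓝 (torusMeasure d)) := by
  refine tendsto_of_tendsto_integral_mFourier fun n ↦ ?_
  by_cases hn : n = 0
  · simp [hn, UnitAddTorus.mFourier_zero]
  have hzero : ∫ x, UnitAddTorus.mFourier n x ∂(torusMeasure d : Measure _) = 0 := by
    have hinv := integral_add_right_eq_self (μ := Measure.pi fun _ : d ↦
      (volume : Measure UnitAddCircle)) (fun x ↦ UnitAddTorus.mFourier n x) θ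
    simp_rw [mFourier_add_apply] at hinv
    rw [integral_mul_const] at hinv
    exact (mul_right_eq_self₀.1 hinv).resolve_left (hθ n hn)
  have hnorm : ‖UnitAddTorus.mFourier n θ‖ = 1 := by
    rw [UnitAddTorus.mFourier, ContinuousMap.coe_mk, norm_prod]
    exact Finset.prod_eq_one fun i _ ↦ Circle.norm_coe _
  rw [hzero]
  refine (tendsto_average_pow_succ hnorm (hθ n hn)).congr fun N ↦ ?_
  rw [empiricalMeasure, ProbabilityMeasure.coe_mk, integral_smul_measure,
    integral_finsetSum_measure fun _ _ ↦ integrable_dirac (by simp)]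
  simp only [integral_dirac, mFourier_nsmul_apply]
  simp [ENNReal.toReal_inv, ENNReal.toReal_add]

theorem volume_circle_im_mem_Icc {a b : ℝ} (ha : -1 ≤ a) (hab : a ≤ b) (hb : b ≤ 1) :
    volume {t : UnitAddCircle | (fourier 1 t).im ∈ Set.Icc a b} =
      ENNReal.ofReal ((arcsin b - arcsin a) / π) := by
  have hπ := pi_pos
  have him (x : ℝ) : (fourier 1 (x : UnitAddCircle)).im = sin (2 * π * x) := by
    rw [fourier_coe_apply, ← Complex.exp_ofReal_mul_I_im]
    congr 2; push_cast; ring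
  have hcont : Continuous fun t : UnitAddCircle ↦ (fourier 1 t).im := by fun_prop
  have hmeas : MeasurableSet {t : UnitAddCircle | (fourier 1 t).im ∈ Set.Icc a b} :=
    hcont.measurable measurableSet_Icc
  set α := arcsin a / (2 * π) with hα
  set β := arcsin b / (2 * π) with hβ
  have hαβ : α ≤ β := by rw [hα, hβ]; gcongr
  have hα' : -(1 / 4) ≤ α := by
    rw [hα, le_div_iff₀ (by positivity)]; linarith [neg_pi_div_two_le_arcsin a]
  have hβ' : β ≤ 1 / 4 := by
    rw [hβ, div_le_iff₀ (by positivity)]; linarith [arcsin_le_pi_div_two b]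
  have hmem {x : ℝ} (hx : x ∈ Set.Icc (-(1 / 4)) (1 / 4 : ℝ)) :
      sin (2 * π * x) ∈ Set.Icc a b ↔ x ∈ Set.Icc α β := by
    have hy : 2 * π * x ∈ Set.Icc (-(π / 2)) (π / 2) :=
      ⟨by nlinarith [hx.1], by nlinarith [hx.2]⟩
    rw [Set.mem_Icc, Set.mem_Icc, ← arcsin_le_iff_le_sin ⟨ha, hab.trans hb⟩ hy,
      ← le_arcsin_iff_sin_le hy ⟨ha.trans hab, hb⟩, hα, hβ, div_le_iff₀' (by positivity),
      le_div_iff₀' (by positivity)]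
  have hrefl (x : ℝ) : sin (2 * π * x) = sin (2 * π * (1 / 2 - x)) := by
    rw [← sin_pi_sub]; congr 1; ring
  rw [← (UnitAddCircle.measurePreserving_mk (-(1 / 4))).measure_preimage hmeas.nullMeasurableSet,
    Measure.restrict_apply (by exact AddCircle.measurable_mk' hmeas)]
  set S : Set ℝ := {x | sin (2 * π * x) ∈ Set.Icc a b} with hS
  have hpre : ((↑) : ℝ → UnitAddCircle) ⁻¹' {t | (fourier 1 t).im ∈ Set.Icc a b} = S := by
    ext x; simp only [Set.mem_preimage, Set.mem_ofPred_eq, him, hS]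
  have hSm : MeasurableSet S := by
    rw [← hpre]; exact AddCircle.measurable_mk' hmeas
  have hleft : volume (S ∩ Set.Ioc (-(1 / 4)) (1 / 4)) = ENNReal.ofReal (β - α) := by
    apply le_antisymm
    · rw [← Real.volume_Icc]
      exact measure_mono fun x hx ↦ (hmem ⟨hx.2.1.le, hx.2.2⟩).1 hx.1
    · rw [← Real.volume_Ioc]
      refine measure_mono fun x hx ↦ ?_
      have hx' : x ∈ Set.Ioc (-(1 / 4)) (1 / 4 : ℝ) := ⟨hα'.trans_lt hx.1, hx.2.trans hβ'⟩
      exact ⟨(hmem ⟨hx'.1.le, hx'.2⟩).2 ⟨hx.1.le, hx.2⟩, hx'⟩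
  have hright : volume (S ∩ Set.Ioc (1 / 4) (3 / 4)) = ENNReal.ofReal (β - α) := by
    have hlen : β - α = (1 / 2 - α) - (1 / 2 - β) := by ring
    rw [hlen]
    apply le_antisymm
    · rw [← Real.volume_Icc]
      refine measure_mono fun x hx ↦ ?_
      have hx1 : sin (2 * π * x) ∈ Set.Icc a b := hx.1
      rw [hrefl, hmem ⟨by linarith [hx.2.2], by linarith [hx.2.1]⟩] at hx1
      exact ⟨by linarith [hx1.2], by linarith [hx1.1]⟩
    · rw [← Real.volume_Ioc]
      refine measure_mono fun x hx ↦ ?_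
      have hx' : x ∈ Set.Ioc (1 / 4 : ℝ) (3 / 4) :=
        ⟨by linarith [hx.1], by linarith [hx.2]⟩
      refine ⟨?_, hx'⟩
      change sin (2 * π * x) ∈ Set.Icc a b
      rw [hrefl, hmem ⟨by linarith [hx'.2], by linarith [hx'.1]⟩]
      exact ⟨by linarith [hx.2], by linarith [hx.1]⟩
  have hsplit : Set.Ioc (-(1 / 4)) (-(1 / 4) + 1) =
      Set.Ioc (-(1 / 4)) (1 / 4) ∪ Set.Ioc (1 / 4) (3 / 4 : ℝ) := by
    rw [Set.Ioc_union_Ioc_eq_Ioc] <;> norm_num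
  rw [hpre, hsplit, Set.inter_union_distrib_left, measure_union _ (hSm.inter measurableSet_Ioc),
    hleft, hright, ← ENNReal.ofReal_add (by linarith) (by linarith)]
  · congr 1; rw [hα, hβ]; field_simp; ring
  · exact (Set.Ioc_disjoint_Ioc_of_le le_rfl).mono Set.inter_subset_right Set.inter_subset_right

theorem volume_frontier_circle_im_mem_Icc {a b : ℝ} (ha : -1 ≤ a) (hab : a ≤ b) (hb : b ≤ 1) :
    volume (frontier {t : UnitAddCircle | (fourier 1 t).im ∈ Set.Icc a b}) = 0 := by
  have hcont : Continuous fun t : UnitAddCircle ↦ (fourier 1 t).im := by fun_prop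
  have hlevel {c : ℝ} (hc : -1 ≤ c) (hc' : c ≤ 1) :
      volume {t : UnitAddCircle | (fourier 1 t).im ∈ Set.Icc c c} = 0 := by
    rw [volume_circle_im_mem_Icc hc le_rfl hc']; simp
  refine measure_mono_null ?_ (measure_union_null (hlevel ha (hab.trans hb))
    (hlevel (ha.trans hab) hb))
  refine (hcont.frontier_preimage_subset (Set.Icc a b)).trans fun t ht ↦ ?_
  simpa [frontier_Icc hab] using ht

/-- Equation (3) of the paper: the counting asymptotic for `(sin(νθ₁), sin(νθ₂))`
landing in a box `[a₁,b₁] × [a₂,b₂] ⊆ [−1,1]²`. -/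
theorem sin_pair_counting_asymptotic
    (θ₁ θ₂ : ℝ) (h₁ : θ₁ ∈ Set.Ioo 0 π) (h₂ : θ₂ ∈ Set.Ioo 0 π)
    (hind : ∀ a b c : ℚ,
      (a : ℝ) + (b : ℝ) * (θ₁ / (2 * π)) + (c : ℝ) * (θ₂ / (2 * π)) = 0 →
      a = 0 ∧ b = 0 ∧ c = 0)
    (a₁ b₁ a₂ b₂ : ℝ)
    (ha₁ : -1 ≤ a₁) (hab₁ : a₁ ≤ b₁) (hb₁ : b₁ ≤ 1)
    (ha₂ : -1 ≤ a₂) (hab₂ : a₂ ≤ b₂) (hb₂ : b₂ ≤ 1) :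
    Tendsto (fun x : ℕ =>
      (Nat.card {ν : ℕ | 1 ≤ ν ∧ ν ≤ x ∧
        Real.sin ((ν : ℝ) * θ₁) ∈ Set.Icc a₁ b₁ ∧
        Real.sin ((ν : ℝ) * θ₂) ∈ Set.Icc a₂ b₂} : ℝ) / (x : ℝ))
      atTop
      (nhds ((Real.arcsin b₁ - Real.arcsin a₁) * (Real.arcsin b₂ - Real.arcsin a₂) / π ^ 2)) := by
  classical
  have hπ := pi_pos
  let θ : UnitAddTorus (Fin 2) :=
    ![((θ₁ / (2 * π) : ℝ) : UnitAddCircle), ((θ₂ / (2 * π) : ℝ) : UnitAddCircle)]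
  have hθ (n : Fin 2 → ℤ) (hn : n ≠ 0) : UnitAddTorus.mFourier n θ ≠ 1 := by
    intro h
    have h' : Complex.exp (2 * π * Complex.I *
        (n 0 * ((θ₁ / (2 * π) : ℝ) : ℂ) + n 1 * ((θ₂ / (2 * π) : ℝ) : ℂ))) = 1 := by
      rw [← h]
      simp only [UnitAddTorus.mFourier, ContinuousMap.coe_mk, Fin.prod_univ_two, θ,
        Matrix.cons_val_zero, Matrix.cons_val_one, fourier_coe_apply, ← Complex.exp_add]
      congr 1; push_cast; ring
    obtain ⟨m, hm⟩ := Complex.exp_eq_one_iff.1 h'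
    have hm' : (n 0 * ((θ₁ / (2 * π) : ℝ) : ℂ) + n 1 * ((θ₂ / (2 * π) : ℝ) : ℂ)) = m :=
      mul_left_cancel₀ Complex.two_pi_I_ne_zero (hm.trans (mul_comm _ _))
    have hm'' : n 0 * (θ₁ / (2 * π)) + n 1 * (θ₂ / (2 * π)) = m := by exact_mod_cast hm'
    obtain ⟨-, h0, h1⟩ := hind (-m) (n 0) (n 1) (by push_cast; linarith)
    exact hn (funext fun i ↦ by fin_cases i; exacts [mod_cast h0, mod_cast h1])
  let A (a b : ℝ) : Set UnitAddCircle := {t | (fourier 1 t).im ∈ Set.Icc a b}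
  let E : Set (UnitAddTorus (Fin 2)) := Set.pi Set.univ ![A a₁ b₁, A a₂ b₂]
  have hE : E = (fun t ↦ t 0) ⁻¹' A a₁ b₁ ∩ (fun t ↦ t 1) ⁻¹' A a₂ b₂ := by
    ext; simp [E, Fin.forall_fin_two]
  have hcont : Continuous fun t : UnitAddCircle ↦ (fourier 1 t).im := by fun_prop
  have hA (a b : ℝ) : MeasurableSet (A a b) := hcont.measurable measurableSet_Icc
  have hEm : MeasurableSet E := by
    rw [hE]
    exact ((measurable_pi_apply 0) (hA _ _)).inter ((measurable_pi_apply 1) (hA _ _))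
  have hvol : (torusMeasure (Fin 2) : Measure _) E = ENNReal.ofReal
      ((arcsin b₁ - arcsin a₁) * (arcsin b₂ - arcsin a₂) / π ^ 2) := by
    have h := sub_nonneg.2 (monotone_arcsin hab₁)
    rw [torusMeasure, ProbabilityMeasure.coe_mk, Measure.pi_pi, Fin.prod_univ_two]
    simp only [Matrix.cons_val_zero, Matrix.cons_val_one, A]
    rw [volume_circle_im_mem_Icc ha₁ hab₁ hb₁, volume_circle_im_mem_Icc ha₂ hab₂ hb₂,
      ← ENNReal.ofReal_mul (by positivity)]
    congr 1; field_simp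
  have hnull (i : Fin 2) {s : Set UnitAddCircle} (hs : volume (frontier s) = 0) :
      (torusMeasure (Fin 2) : Measure _) 
        (frontier ((fun t : UnitAddTorus (Fin 2) ↦ t i) ⁻¹' s)) = 0 := by
    refine measure_mono_null (Continuous.frontier_preimage_subset
      (f := fun t : UnitAddTorus (Fin 2) ↦ t i) (by fun_prop) s) ?_
    have : IsProbabilityMeasure (volume : Measure UnitAddCircle) := ⟨UnitAddCircle.measure_univ⟩
    exact (measurePreserving_eval (fun _ : Fin 2 ↦ (volume : Measure UnitAddCircle))
      i).quasiMeasurePreserving.preimage_null hs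
  have hfront : (torusMeasure (Fin 2) : Measure _) (frontier E) = 0 := by
    rw [hE]
    refine measure_mono_null (frontier_inter_subset _ _) (measure_union_null ?_ ?_)
    · exact measure_mono_null Set.inter_subset_left
        (hnull 0 (volume_frontier_circle_im_mem_Icc ha₁ hab₁ hb₁))
    · exact measure_mono_null Set.inter_subset_right
        (hnull 1 (volume_frontier_circle_im_mem_Icc ha₂ hab₂ hb₂))
  have hlim := (ENNReal.tendsto_toReal (measure_ne_top _ _)).comp
    (ProbabilityMeasure.tendsto_measure_of_null_frontier_of_tendsto'
      (tendsto_empiricalMeasure hθ) hfront)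
  rw [hvol, ENNReal.toReal_ofReal (div_nonneg (mul_nonneg (sub_nonneg.2 (monotone_arcsin hab₁))
    (sub_nonneg.2 (monotone_arcsin hab₂))) (sq_nonneg _))] at hlim
  rw [← tendsto_add_atTop_iff_nat 1]
  refine hlim.congr fun N ↦ ?_
  have him (ν : ℕ) (φ : ℝ) : (fourier 1 (ν • ((φ / (2 * π) : ℝ) : UnitAddCircle))).im =
      sin (ν * φ) := by
    rw [← AddCircle.coe_nsmul, fourier_coe_apply, ← Complex.exp_ofReal_mul_I_im]
    congr 2; rw [nsmul_eq_mul]; push_cast; field_simp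
  have hmem (ν : ℕ) : ν • θ ∈ E ↔
      sin (ν * θ₁) ∈ Set.Icc a₁ b₁ ∧ sin (ν * θ₂) ∈ Set.Icc a₂ b₂ := by
    rw [hE, ← him, ← him]; rfl
  have hset : {ν : ℕ | 1 ≤ ν ∧ ν ≤ N + 1 ∧ sin ((ν : ℝ) * θ₁) ∈ Set.Icc a₁ b₁ ∧
      sin ((ν : ℝ) * θ₂) ∈ Set.Icc a₂ b₂} =
      (((Finset.range (N + 1)).filter fun k ↦ (k + 1) • θ ∈ E).image (· + 1) : Finset ℕ) := by
    ext ν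
    simp only [← hmem, Set.mem_ofPred_eq, Finset.coe_image, Finset.coe_filter, Finset.mem_range,
      Set.mem_image]
    constructor
    · rintro ⟨h1, h2, h3⟩
      obtain ⟨k, rfl⟩ := Nat.exists_eq_add_of_le' h1
      exact ⟨k, ⟨by lia, h3⟩, rfl⟩
    · rintro ⟨k, ⟨h2, h3⟩, rfl⟩
      exact ⟨by lia, by lia, h3⟩
  rw [hset, Nat.card_coe_set_eq, Set.ncard_coe_finset,
    Finset.card_image_of_injective _ (add_left_injective 1)]
  simp only [Function.comp_apply, empiricalMeasure, ProbabilityMeasure.coe_mk,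
    Measure.smul_apply, Measure.finsetSum_apply, smul_eq_mul, Measure.dirac_apply' _ hEm,
    Set.indicator_apply, Pi.one_apply, Finset.sum_boole, ENNReal.toReal_mul, ENNReal.toReal_inv,
    ENNReal.toReal_natCast]
  rw [inv_mul_eq_div]
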